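/- Let d > 1 and k > 1 be integers. If there exists a prime ℓ with ℓ(d−1) < k + 1 and gcd(ℓ,k) = 1, then there is no almost Moore digraph of degree d and diameter k with self-repeats and permutation cycle structure (k, …, m_{d−1}, 0, …, 0). -/

import Mathlib

/-- `IsWalkFrom A u v l` : the list `u :: l` is a directed walk from `u` to `v`
along the adjacency relation `A`; the length of the walk is `l.length`. -/
def IsWalkFrom {V : Type} (A : V → V → Prop) (u v : V) (l : List V) : Prop :=
  List.Chain A u l ∧ (u :: l).getLast (List.cons_ne_nil u l) = v

/-- An almost Moore digraph (a `(d,k)`-digraph): a diregular digraph of degree `d > 1`,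
diameter `k > 1` and order `d + d² + ⋯ + d^k`, together with its repeat permutation `rep`:
for every vertex `v`, every vertex `w ≠ rep v` is reached from `v` by exactly one walk of
length at most `k`, while `rep v` is reached by exactly two such walks, at least one of
which has length `k`.  The map `rep` is an automorphism of the digraph. -/
structure AlmostMooreDigraph (d k : ℕ) where
  hd : 1 < d
  hk : 1 < k
  V : Type
  [fintypeV : Fintype V]
  [decEqV : DecidableEq V]
  Adj : V → V → Prop
  [adjDec : DecidableRel Adj]
  loopless : ∀ v, ¬ Adj v v
  out_deg : ∀ v, {w | Adj v w}.ncard = d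
  in_deg : ∀ v, {w | Adj w v}.ncard = d
  reach : ∀ u v, ∃ l, IsWalkFrom Adj u v l ∧ l.length ≤ k
  diam : ∃ u v, ∀ l, IsWalkFrom Adj u v l → k ≤ l.length
  card_eq : Fintype.card V = ∑ i ∈ Finset.range k, d ^ (i + 1)
  rep : V → V
  rep_spec : ∀ v w, w ≠ rep v → ∃! l, IsWalkFrom Adj v w l ∧ l.length ≤ k
  rep_two : ∀ v, ∃ l₁ l₂, l₁ ≠ l₂ ∧
      IsWalkFrom Adj v (rep v) l₁ ∧ l₁.length ≤ k ∧
      IsWalkFrom Adj v (rep v) l₂ ∧ l₂.length ≤ k ∧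
      (l₁.length = k ∨ l₂.length = k) ∧
      (∀ l, IsWalkFrom Adj v (rep v) l → l.length ≤ k → l = l₁ ∨ l = l₂)
  rep_bijective : Function.Bijective rep
  rep_adj : ∀ u v, Adj u v ↔ Adj (rep u) (rep v)

attribute [instance] AlmostMooreDigraph.fintypeV AlmostMooreDigraph.decEqV
  AlmostMooreDigraph.adjDec

/-- `ordRep M v` : the smallest `t ≥ 1` with `rep^t v = v`. -/
noncomputable def ordRep {d k : ℕ} (M : AlmostMooreDigraph d k) (v : M.V) : ℕ :=
  sInf {t | 0 < t ∧ M.rep^[t] v = v}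

/-- The vertex set of the subdigraph `H_α`: vertices whose order under the repeat
permutation divides `2^t * α` for some `t ≥ 0`. -/
def Hset {d k : ℕ} (M : AlmostMooreDigraph d k) (α : ℕ) : Set M.V :=
  {v | ∃ t : ℕ, ordRep M v ∣ 2 ^ t * α}

open Finset in
/-- The finset of lists `l` such that `u :: l` is a walk of length `i` from `u` to `v`. -/
def walkLists {V : Type} [Fintype V] [DecidableEq V] (A : V → V → Prop) [DecidableRel A] :
    ℕ → V → V → Finset (List V)
  | 0, u, v => if u = v then {[]} else ∅
  | i + 1, u, v => (univ.filter (A u)).biUnion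
      fun w => (walkLists A i w v).map ⟨List.cons w, List.cons_injective⟩

theorem isWalkFrom_nil {V : Type} (A : V → V → Prop) {u v : V} : IsWalkFrom A u v [] ↔ u = v := by
  simp [IsWalkFrom, List.Chain]

theorem isWalkFrom_cons {V : Type} (A : V → V → Prop) {u v w : V}
    {l : List V} :
    IsWalkFrom A u v (w :: l) ↔ A u w ∧ IsWalkFrom A w v l := by
  simp [IsWalkFrom, List.Chain, and_assoc]

section Walks

variable {V : Type} [Fintype V] [DecidableEq V] (A : V → V → Prop) [DecidableRel A]

theorem mem_walkLists {i : ℕ} {u v : V} {l : List V} :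
    l ∈ walkLists A i u v ↔ IsWalkFrom A u v l ∧ l.length = i := by
  induction i generalizing u l with
  | zero =>
    rw [walkLists, List.length_eq_zero_iff]
    constructor
    · intro h
      split_ifs at h with huv
      · rw [Finset.mem_singleton] at h
        subst h
        exact ⟨(isWalkFrom_nil A).2 huv, rfl⟩
      · simp at h
    · rintro ⟨h, rfl⟩
      rw [if_pos ((isWalkFrom_nil A).1 h)]
      simp
  | succ i ih =>
    cases l with
    | nil => simp [walkLists]
    | cons w l =>
      rw [isWalkFrom_cons, List.length_cons, Nat.add_right_cancel_iff, and_assoc, ← ih]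
      simp [walkLists]

/-- The integer adjacency matrix of a relation. -/
def adjMat : Matrix V V ℤ := Matrix.of fun u v => if A u v then 1 else 0

theorem adjMat_pow_apply (i : ℕ) (u v : V) :
    (adjMat A ^ i) u v = (walkLists A i u v).card := by
  induction i generalizing u with
  | zero =>
    rw [pow_zero, Matrix.one_apply, walkLists]
    split_ifs <;> simp
  | succ i ih =>
    rw [pow_succ', Matrix.mul_apply, walkLists, Finset.card_biUnion]
    · push_cast
      rw [Finset.sum_filter]
      refine Finset.sum_congr rfl fun w _ => ?_
      rw [ih]
      simp [adjMat]
    · intro w _ w' _ hne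
      rw [Function.onFun, Finset.disjoint_left]
      intro l h h'
      simp only [Finset.mem_map, Function.Embedding.coeFn_mk] at h h'
      obtain ⟨_, _, rfl⟩ := h
      obtain ⟨_, _, h'⟩ := h'
      exact hne (List.cons.inj h').1.symm

theorem adjMat_pow_pos_iff {i : ℕ} {u v : V} :
    0 < (adjMat A ^ i) u v ↔ ∃ l, IsWalkFrom A u v l ∧ l.length = i := by
  rw [adjMat_pow_apply, Nat.cast_pos, Finset.card_pos]
  exact exists_congr fun l => mem_walkLists A

theorem adjMat_pow_add_pos {i j : ℕ} {u v w : V} (h : 0 < (adjMat A ^ i) u v)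
    (h' : 0 < (adjMat A ^ j) v w) : 0 < (adjMat A ^ (i + j)) u w := by
  rw [pow_add, Matrix.mul_apply]
  refine Finset.sum_pos' (fun x _ => ?_) ⟨v, Finset.mem_univ v, mul_pos h h'⟩
  rw [adjMat_pow_apply, adjMat_pow_apply]
  positivity

theorem adjMat_pow_perm_apply (σ : Equiv.Perm V) (hσ : ∀ u v, A u v ↔ A (σ u) (σ v)) (i : ℕ)
    (u v : V) : (adjMat A ^ i) (σ u) (σ v) = (adjMat A ^ i) u v := by
  induction i generalizing u with
  | zero => simp [Matrix.one_apply]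
  | succ i ih =>
    rw [pow_succ', Matrix.mul_apply, Matrix.mul_apply, ← Equiv.sum_comp σ]
    refine Finset.sum_congr rfl fun w _ => ?_
    rw [ih]
    simp [adjMat, ← hσ]

/-- A walk from `u` to its image under an automorphism `σ`, iterated `n` times. -/
theorem adjMat_pow_mul_pos (σ : Equiv.Perm V) (hσ : ∀ u v, A u v ↔ A (σ u) (σ v)) {i : ℕ}
    {u : V} (h : 0 < (adjMat A ^ i) u (σ u)) (n : ℕ) :
    0 < (adjMat A ^ (n * i)) u ((σ ^ n) u) := by
  induction n with
  | zero => simp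
  | succ n ih =>
    rw [Nat.succ_mul, add_comm, pow_succ', Equiv.Perm.mul_apply]
    exact adjMat_pow_add_pos A h ((adjMat_pow_perm_apply A σ hσ _ _ _).symm ▸ ih)

end Walks

section Trace

variable {Ω : Type} [Fintype Ω] [DecidableEq Ω]

theorem trace_pow_add_mul_sub {d k : ℕ} {B K : Matrix Ω Ω ℤ} (hBK : B * K = (d : ℤ) • K)
    (hsum : ∑ i ∈ Finset.range (k + 1), B ^ i = K + 1)
    (hK : K.trace = ∑ i ∈ Finset.range k, (d : ℤ) ^ (i + 1)) (i t : ℕ) :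
    (B ^ (i + 1 + k * t)).trace - (d : ℤ) ^ (i + 1 + k * t) =
      (B ^ (i + 1)).trace - (d : ℤ) ^ (i + 1) := by
  have hpow : ∀ j : ℕ, B ^ j * K = ((d : ℤ) ^ j) • K := by
    intro j
    induction j with
    | zero => simp
    | succ j ih => rw [pow_succ, mul_assoc, hBK, mul_smul_comm, ih, smul_smul, pow_succ']
  have hB : B ^ (k + 1) = B + ((d : ℤ) - 1) • K := by
    have h := mul_geom_sum B (k + 1)
    rw [hsum, sub_mul, mul_add, hBK, mul_one, one_mul] at h
    rw [sub_smul, one_smul, ← sub_add_cancel (B ^ (k + 1)) 1, ← h]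
    abel
  have hN : ((d : ℤ) - 1) * K.trace = (d : ℤ) ^ (k + 1) - d := by
    have h := mul_geom_sum (d : ℤ) k
    simp_rw [hK, pow_succ, ← Finset.sum_mul, ← mul_assoc, h]
    ring
  have hstep : ∀ j : ℕ, (B ^ (j + 1 + k)).trace - (d : ℤ) ^ (j + 1 + k) =
      (B ^ (j + 1)).trace - (d : ℤ) ^ (j + 1) := by
    intro j
    rw [show j + 1 + k = j + (k + 1) by ring, pow_add, hB, mul_add, ← pow_succ, mul_smul_comm,
      hpow, Matrix.trace_add, Matrix.trace_smul, Matrix.trace_smul, smul_eq_mul, smul_eq_mul]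
    linear_combination (d : ℤ) ^ j * hN
  induction t with
  | zero => simp
  | succ t ih =>
    rw [← ih, show i + 1 + k * (t + 1) = (i + k * t) + 1 + k by ring, hstep,
      show i + k * t + 1 = i + 1 + k * t by ring]

/-- If, apart from a simple eigenvalue `d`, all nonzero eigenvalues of the integer matrix `B` are
`k`-th roots of unity, then the sums of the first and of the `ℓ`-th powers of the remaining
eigenvalues agree for every `ℓ` coprime to `k`. -/
theorem trace_pow_sub_eq_of_coprime {d k ℓ : ℕ} (hk : 0 < k) (hℓ : 0 < ℓ) (hcop : ℓ.Coprime k)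
    {B K : Matrix Ω Ω ℤ} (hBK : B * K = (d : ℤ) • K)
    (hsum : ∑ i ∈ Finset.range (k + 1), B ^ i = K + 1)
    (hK : K.trace = ∑ i ∈ Finset.range k, (d : ℤ) ^ (i + 1)) :
    (B ^ ℓ).trace - (d : ℤ) ^ ℓ = B.trace - d := by
  set e : ℤ := ((B ^ ℓ).trace - (d : ℤ) ^ ℓ) - (B.trace - d) with he
  obtain ⟨p, hpgt, hp, hmod⟩ :=
    Nat.forall_exists_prime_gt_and_modEq (ℓ + e.natAbs) hk.ne' hcop
  have : Fact p.Prime := ⟨hp⟩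
  obtain ⟨t, ht⟩ := (Nat.modEq_iff_dvd' (by omega)).1 hmod.symm
  obtain ⟨i, rfl⟩ := Nat.exists_eq_succ_of_ne_zero hℓ.ne'
  have hper := trace_pow_add_mul_sub hBK hsum hK i t
  rw [← ht, show i + 1 + (p - i.succ) = p by omega] at hper
  have hdvd : (p : ℤ) ∣ e := by
    rw [← ZMod.intCast_zmod_eq_zero_iff_dvd, he, Nat.succ_eq_add_one, ← hper]
    have htr : ∀ C : Matrix Ω Ω ℤ,
        ((C.trace : ℤ) : ZMod p) = (C.map (Int.castRingHom (ZMod p))).trace := by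
      intro C
      simp [Matrix.trace]
    have hfrob : (((B ^ p).trace : ℤ) : ZMod p) = ((B.trace : ℤ) : ZMod p) := by
      rw [htr, htr, Matrix.map_pow, ZMod.trace_pow_card, ZMod.pow_card]
    push_cast
    rw [hfrob, ZMod.pow_card]
    ring
  have := Int.eq_zero_of_dvd_of_natAbs_lt_natAbs hdvd (by simp; omega)
  omega

end Trace

namespace AlmostMooreDigraph

variable {d k : ℕ} (M : AlmostMooreDigraph d k)

/-- The repeat map as a permutation. -/
noncomputable def repPerm : Equiv.Perm M.V := Equiv.ofBijective M.rep M.rep_bijective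

theorem repPerm_apply (v : M.V) : M.repPerm v = M.rep v := rfl

theorem repPerm_pow_apply (n : ℕ) (v : M.V) : (M.repPerm ^ n) v = M.rep^[n] v := by
  rw [Equiv.Perm.coe_pow]
  rfl

theorem adj_repPerm_pow (n : ℕ) (u v : M.V) :
    M.Adj u v ↔ M.Adj ((M.repPerm ^ n) u) ((M.repPerm ^ n) v) := by
  induction n with
  | zero => simp
  | succ n ih =>
    rw [ih, M.rep_adj, pow_succ', Equiv.Perm.mul_apply, Equiv.Perm.mul_apply]
    rfl

theorem ordRep_spec (v : M.V) : 0 < ordRep M v ∧ (M.repPerm ^ ordRep M v) v = v := by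
  rw [repPerm_pow_apply]
  refine Nat.sInf_mem (s := {t | 0 < t ∧ M.rep^[t] v = v})
    ⟨orderOf M.repPerm, orderOf_pos _, ?_⟩
  rw [← repPerm_pow_apply, pow_orderOf_eq_one]
  rfl

theorem sum_adjMat_pow_apply (u v : M.V) :
    ∑ i ∈ Finset.range (k + 1), (adjMat M.Adj ^ i) u v = 1 + if v = M.rep u then 1 else 0 := by
  simp_rw [adjMat_pow_apply]
  rw [← Nat.cast_sum, ← Finset.card_biUnion]
  · set s := (Finset.range (k + 1)).biUnion fun i => walkLists M.Adj i u v
    have hs : ∀ l, l ∈ s ↔ IsWalkFrom M.Adj u v l ∧ l.length ≤ k := by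
      intro l
      simp [s, mem_walkLists, and_comm]
    split_ifs with h
    · subst h
      obtain ⟨l₁, l₂, hne, h₁, h₁k, h₂, h₂k, -, hall⟩ := M.rep_two u
      have : s = {l₁, l₂} := by
        ext l
        rw [hs, Finset.mem_insert, Finset.mem_singleton]
        constructor
        · rintro ⟨h, h'⟩
          exact hall l h h'
        · rintro (rfl | rfl)
          exacts [⟨h₁, h₁k⟩, ⟨h₂, h₂k⟩]
      rw [this, Finset.card_pair hne]
      rfl
    · obtain ⟨l, hl, huniq⟩ := M.rep_spec u v h
      have : s = {l} := by
        ext l'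
        rw [hs, Finset.mem_singleton]
        exact ⟨fun h => huniq l' h, fun h => h ▸ hl⟩
      rw [this]
      simp
  · intro i _ j _ hne
    rw [Function.onFun, Finset.disjoint_left]
    intro l hi hj
    rw [mem_walkLists] at hi hj
    exact hne (hi.2.symm.trans hj.2)

/-- A closed walk of length between `1` and `k` has length `k` and starts at a self-repeat. -/
theorem eq_of_closed_walk {v : M.V} {i : ℕ} (hi : 0 < i) (hik : i ≤ k)
    (h : 0 < (adjMat M.Adj ^ i) v v) : M.rep v = v ∧ i = k := by
  obtain ⟨l, hl, rfl⟩ := (adjMat_pow_pos_iff M.Adj).1 h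
  have hnil : IsWalkFrom M.Adj v v [] := (isWalkFrom_nil _).2 rfl
  have hne : l ≠ [] := List.length_pos_iff.1 hi
  have hrep : M.rep v = v := by
    by_contra hcon
    exact hne ((M.rep_spec v v (Ne.symm hcon)).unique ⟨hl, hik⟩ ⟨hnil, by simp⟩)
  refine ⟨hrep, ?_⟩
  obtain ⟨l₁, l₂, -, -, -, -, -, hlen, hall⟩ := M.rep_two v
  rw [hrep] at hall
  have h₁ := hall l hl hik
  have h₂ := hall [] hnil (by simp)
  have hk := M.hk
  rcases h₁ with rfl | rfl <;> rcases h₂ with rfl | rfl <;> simp_all <;> omega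

/-- The setoid of orbits of the repeat permutation. -/
noncomputable abbrev orbitSetoid : Setoid M.V := Equiv.Perm.SameCycle.setoid M.repPerm

/-- The orbits of the repeat permutation. -/
abbrev Orbit : Type := Quotient M.orbitSetoid

noncomputable instance : Fintype M.Orbit := Fintype.ofFinite _

noncomputable instance : DecidableEq M.Orbit := Classical.decEq _

/-- The incidence matrix between vertices and orbits. -/
noncomputable def incMat : Matrix M.V M.Orbit ℤ :=
  Matrix.of fun v o => if (Quotient.mk M.orbitSetoid v) = o then 1 else 0

/-- The matrix selecting a representative in each orbit. -/
noncomputable def selMat : Matrix M.Orbit M.V ℤ :=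
  Matrix.of fun o v => if o.out = v then 1 else 0

theorem selMat_mul_apply {n : Type} (X : Matrix M.V n ℤ) (o : M.Orbit) (j : n) :
    (M.selMat * X) o j = X o.out j := by
  simp [Matrix.mul_apply, selMat]

theorem incMat_mul_apply {n : Type} (X : Matrix M.Orbit n ℤ) (v : M.V) (j : n) :
    (M.incMat * X) v j = X (Quotient.mk M.orbitSetoid v) j := by
  simp [Matrix.mul_apply, incMat]

theorem selMat_mul_incMat : M.selMat * M.incMat = 1 := by
  ext o o'
  rw [selMat_mul_apply]
  simp [incMat, Matrix.one_apply]

theorem incMat_rep (v : M.V) (o : M.Orbit) : M.incMat (M.rep v) o = M.incMat v o := by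
  have : (Quotient.mk M.orbitSetoid (M.rep v)) = Quotient.mk M.orbitSetoid v :=
    Quotient.sound (s := M.orbitSetoid)
      (Equiv.Perm.SameCycle.symm ⟨1, by rw [zpow_one, repPerm_apply]⟩)
  simp [incMat, this]

/-- The quotient matrix of the adjacency matrix by the orbits of the repeat permutation. -/
noncomputable def quotMat : Matrix M.Orbit M.Orbit ℤ := M.selMat * adjMat M.Adj * M.incMat

theorem adjMat_mul_incMat_rep (v : M.V) (o : M.Orbit) :
    (adjMat M.Adj * M.incMat) (M.rep v) o = (adjMat M.Adj * M.incMat) v o := by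
  rw [Matrix.mul_apply, Matrix.mul_apply, ← Equiv.sum_comp M.repPerm]
  refine Finset.sum_congr rfl fun w _ => ?_
  rw [repPerm_apply, incMat_rep]
  simp [adjMat, ← M.rep_adj]

theorem adjMat_mul_incMat : adjMat M.Adj * M.incMat = M.incMat * M.quotMat := by
  ext v o
  rw [incMat_mul_apply, quotMat, Matrix.mul_assoc, selMat_mul_apply]
  have hrel : M.repPerm.SameCycle v (Quotient.mk M.orbitSetoid v).out :=
    Equiv.Perm.SameCycle.symm (Quotient.mk_out (s := M.orbitSetoid) v)
  obtain ⟨n, -, hn⟩ := hrel.exists_pow_eq'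
  rw [← hn]
  clear hn hrel
  induction n with
  | zero => simp
  | succ n ih => rw [ih, pow_succ', Equiv.Perm.mul_apply, repPerm_apply, adjMat_mul_incMat_rep]

theorem adjMat_pow_mul_incMat (i : ℕ) :
    adjMat M.Adj ^ i * M.incMat = M.incMat * M.quotMat ^ i := by
  induction i with
  | zero => simp
  | succ i ih =>
    rw [pow_succ, Matrix.mul_assoc, adjMat_mul_incMat, ← Matrix.mul_assoc, ih, Matrix.mul_assoc, ← pow_succ]

theorem quotMat_pow (i : ℕ) :
    M.quotMat ^ i = M.selMat * (adjMat M.Adj ^ i * M.incMat) := by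
  rw [adjMat_pow_mul_incMat, ← Matrix.mul_assoc, selMat_mul_incMat, Matrix.one_mul]

/-- The matrix with all entries in the column of an orbit equal to the size of that orbit. -/
noncomputable def sizeMat : Matrix M.Orbit M.Orbit ℤ :=
  M.selMat * ((Matrix.of fun _ _ => 1 : Matrix M.V M.V ℤ) * M.incMat)

theorem incMat_mul_sizeMat :
    M.incMat * M.sizeMat = (Matrix.of fun _ _ => 1 : Matrix M.V M.V ℤ) * M.incMat := by
  ext v o
  rw [incMat_mul_apply, sizeMat, selMat_mul_apply, Matrix.mul_apply, Matrix.mul_apply]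
  rfl

theorem sum_quotMat_pow : ∑ i ∈ Finset.range (k + 1), M.quotMat ^ i = M.sizeMat + 1 := by
  simp_rw [quotMat_pow]
  rw [← Matrix.mul_sum, ← Matrix.sum_mul, ← selMat_mul_incMat, sizeMat, ← Matrix.mul_add]
  congr 1
  ext v o
  rw [Matrix.add_apply, Matrix.mul_apply, Matrix.mul_apply]
  simp_rw [Matrix.sum_apply, sum_adjMat_pow_apply, add_mul, Finset.sum_add_distrib]
  simp [incMat_rep]

theorem quotMat_mul_sizeMat : M.quotMat * M.sizeMat = (d : ℤ) • M.sizeMat := by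
  have hAJ : adjMat M.Adj * (Matrix.of fun _ _ => 1 : Matrix M.V M.V ℤ) =
      (d : ℤ) • (Matrix.of fun _ _ => 1 : Matrix M.V M.V ℤ) := by
    ext u v
    have h := M.out_deg u
    rw [Set.ncard_eq_toFinset_card'] at h
    simp [Matrix.mul_apply, adjMat, ← h]
  rw [quotMat, Matrix.mul_assoc, Matrix.mul_assoc, incMat_mul_sizeMat, ← Matrix.mul_assoc (adjMat M.Adj), hAJ,
    Matrix.smul_mul, Matrix.mul_smul, sizeMat]

theorem trace_sizeMat : M.sizeMat.trace = ∑ i ∈ Finset.range k, (d : ℤ) ^ (i + 1) := by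
  rw [sizeMat, ← Matrix.mul_assoc, Matrix.trace_mul_comm, ← Matrix.mul_assoc]
  have h : ((M.incMat * M.selMat) * (Matrix.of fun _ _ => 1 : Matrix M.V M.V ℤ)) =
      Matrix.of fun _ _ => 1 := by
    ext v w
    rw [Matrix.mul_assoc, incMat_mul_apply, selMat_mul_apply]
    rfl
  rw [h]
  have := M.card_eq
  simp only [Matrix.trace, Matrix.diag_apply, Matrix.of_apply, Finset.sum_const,
    Finset.card_univ, this]
  simp

theorem trace_quotMat_pow_eq_zero {m i : ℕ} (hord : ∀ v : M.V, ordRep M v ≤ m) (hi : 0 < i)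
    (him : i * m ≤ k) (hik : i < k) : (M.quotMat ^ i).trace = 0 := by
  refine Finset.sum_eq_zero fun o _ => ?_
  rw [Matrix.diag_apply, quotMat_pow, selMat_mul_apply, Matrix.mul_apply]
  refine Finset.sum_eq_zero fun w _ => ?_
  by_cases hw : Quotient.mk M.orbitSetoid w = o
  · subst hw
    set v := (Quotient.mk M.orbitSetoid w).out
    have hrel : M.repPerm.SameCycle v w := Quotient.mk_out (s := M.orbitSetoid) w
    obtain ⟨n, -, hn⟩ := hrel.exists_pow_eq'
    suffices h : ¬ 0 < (adjMat M.Adj ^ i) v w by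
      have h0 : (adjMat M.Adj ^ i) v w = 0 := by
        refine le_antisymm (not_lt.1 h) ?_
        rw [adjMat_pow_apply]
        positivity
      rw [h0, zero_mul]
    intro hpos
    obtain ⟨hpos', hord'⟩ := M.ordRep_spec v
    have hle := hord v
    have hclosed : 0 < (adjMat M.Adj ^ (ordRep M v * i)) v v := by
      have h := adjMat_pow_mul_pos M.Adj (M.repPerm ^ n) (M.adj_repPerm_pow n)
        (hn.symm ▸ hpos) (ordRep M v)
      rwa [← pow_mul, mul_comm n, pow_mul M.repPerm,
        Equiv.Perm.pow_apply_eq_self_of_apply_eq_self hord'] at h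
    have hlen : ordRep M v * i ≤ k := by nlinarith
    obtain ⟨hfix, -⟩ := M.eq_of_closed_walk (Nat.mul_pos hpos' hi) hlen hclosed
    have hvw : v = w := by
      rw [← hn, Equiv.Perm.pow_apply_eq_self_of_apply_eq_self]
      exact hfix
    rw [← hvw] at hpos
    exact hik.ne (M.eq_of_closed_walk hi hik.le hpos).2
  · simp [incMat, hw]

end AlmostMooreDigraph

/-- Let `d > 1` and `k > 1`.  If there exists a prime `ℓ` with
`ℓ(d−1) < k + 1` and `gcd(ℓ, k) = 1`, then there is no almost Moore digraph of degree `d`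
and diameter `k` with self-repeats and permutation cycle structure
`(k, …, m_{d−1}, 0, …, 0)` (i.e. with exactly `k` fixed points of `r` and every vertex of
order at most `d − 1` under `r`). -/
theorem stmt15 (d k : ℕ) (hd : 1 < d) (hk : 1 < k) (ℓ : ℕ) (hp : ℓ.Prime)
    (hbound : ℓ * (d - 1) < k + 1) (hgcd : Nat.gcd ℓ k = 1) :
    ¬ ∃ M : AlmostMooreDigraph d k, (∃ v, M.rep v = v) ∧
        {v | M.rep v = v}.ncard = k ∧ ∀ v : M.V, ordRep M v ≤ d - 1 := by
  rintro ⟨M, -, -, hord⟩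
  have hℓ := hp.two_le
  have hℓk : ℓ ≤ k := by
    have : ℓ * 1 ≤ ℓ * (d - 1) := Nat.mul_le_mul_left _ (by omega)
    omega
  have hne : ℓ ≠ k := by
    rintro rfl
    rw [Nat.gcd_self] at hgcd
    omega
  have htrace := trace_pow_sub_eq_of_coprime (by omega) hp.pos hgcd
    M.quotMat_mul_sizeMat M.sum_quotMat_pow M.trace_sizeMat
  have h₁ : M.quotMat.trace = 0 := by
    rw [← pow_one M.quotMat]
    refine M.trace_quotMat_pow_eq_zero hord one_pos ?_ (by omega)
    exact (Nat.mul_le_mul_right _ hp.one_le).trans (by omega)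
  rw [h₁, M.trace_quotMat_pow_eq_zero hord hp.pos (by omega) (by omega)] at htrace
  have hpow : d ^ 1 < d ^ ℓ := Nat.pow_lt_pow_right hd (by omega)
  rw [pow_one] at hpow
  zify at hpow
  omega
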